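/- arXiv:1910.00308 — 2 statements merged into one kernel-verified Lean document; each statement's English description precedes it below -/
import Mathlib

section
/- Let 0 < p < 1 be a probability. There exists a constant c > 0 depending only on p such that for all positive integers n and m with m ≤ 1/(1-p)^{(1-p)n}, the expected number of minimal edges satisfies c·m ≤ E[|min(B_{n,m,p})|] ≤ m. -/
open MeasureTheory

/-- The Bernoulli(p) measure on `Bool`. -/
noncomputable def bernoulliBool (p : ℝ) : Measure Bool :=
  ENNReal.ofReal p • Measure.dirac true + ENNReal.ofReal (1 - p) • Measure.dirac false

instance (p : ℝ) : IsFiniteMeasure (bernoulliBool p) := by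
  constructor
  rw [bernoulliBool]
  simp [ENNReal.add_lt_top]

/-- The law of `m` i.i.d. random subsets of `{1,…,n}` (encoded as indicator vectors),
each element included independently with probability `p`. -/
noncomputable def hyperMeasure (n m : ℕ) (p : ℝ) : Measure (Fin m → Fin n → Bool) :=
  Measure.pi fun _ : Fin m => Measure.pi fun _ : Fin n => bernoulliBool p

/-- The subset of `Fin n` encoded by an indicator vector. -/
def toSet {n : ℕ} (f : Fin n → Bool) : Finset (Fin n) :=
  Finset.univ.filter fun i => f i = true

/-- The number of distinct minimal edges of the sampled multi-hypergraph:
sets `S` that occur among the samples and such that no sample is a proper subset of `S`. -/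
def minCount (n m : ℕ) (ω : Fin m → Fin n → Bool) : ℕ :=
  (Finset.univ.filter fun S : Finset (Fin n) =>
    (∃ j, toSet (ω j) = S) ∧ ∀ k, ¬ toSet (ω k) ⊂ S).card

/-- Expected size of the minimization of `B_{n,m,p}`. -/
noncomputable def expMin (n m : ℕ) (p : ℝ) : ℝ :=
  ∫ ω, (minCount n m ω : ℝ) ∂(hyperMeasure n m p)

/-- The mass that the Bernoulli(p) measure gives to a point of `Bool`. -/
def bernoulliWeight (p : ℝ) (b : Bool) : ℝ := if b then p else 1 - p

/-- The mass of an indicator vector under the product of Bernoulli(p) measures. -/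
def vecWeight (p : ℝ) {n : ℕ} (x : Fin n → Bool) : ℝ := ∏ i, bernoulliWeight p (x i)

/-- The centred size of the set encoded by an indicator vector. -/
def centredSize (p : ℝ) {n : ℕ} (x : Fin n → Bool) : ℝ :=
  ∑ i, ((if x i then 1 else 0) - p)

section Weights

variable {p : ℝ}

lemma bernoulliWeight_nonneg (hp0 : 0 ≤ p) (hp1 : p ≤ 1) (b : Bool) :
    0 ≤ bernoulliWeight p b := by
  unfold bernoulliWeight
  split_ifs <;> linarith

lemma vecWeight_nonneg (hp0 : 0 ≤ p) (hp1 : p ≤ 1) {n : ℕ} (x : Fin n → Bool) :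
    0 ≤ vecWeight p x :=
  Finset.prod_nonneg fun _ _ => bernoulliWeight_nonneg hp0 hp1 _

lemma sum_vecWeight (p : ℝ) (n : ℕ) : ∑ x : Fin n → Bool, vecWeight p x = 1 := by
  unfold vecWeight
  rw [← Fintype.prod_sum]
  simp [bernoulliWeight]

lemma bernoulliBool_real_singleton (hp0 : 0 ≤ p) (hp1 : p ≤ 1) (b : Bool) :
    (bernoulliBool p).real {b} = bernoulliWeight p b := by
  have h : 0 ≤ 1 - p := by linarith
  cases b <;> simp [bernoulliBool, bernoulliWeight, Measure.real, hp0, h]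

lemma hyperMeasure_real_singleton (hp0 : 0 ≤ p) (hp1 : p ≤ 1) {n m : ℕ}
    (ω : Fin m → Fin n → Bool) :
    (hyperMeasure n m p).real {ω} = ∏ j, vecWeight p (ω j) := by
  rw [hyperMeasure, Measure.real, Measure.pi_singleton, ENNReal.toReal_prod]
  refine Finset.prod_congr rfl fun j _ => ?_
  rw [Measure.pi_singleton, ENNReal.toReal_prod]
  exact Finset.prod_congr rfl fun i _ => bernoulliBool_real_singleton hp0 hp1 _

instance (n m : ℕ) (p : ℝ) : IsFiniteMeasure (hyperMeasure n m p) := by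
  unfold hyperMeasure
  infer_instance

lemma expMin_eq_sum (hp0 : 0 ≤ p) (hp1 : p ≤ 1) (n m : ℕ) :
    expMin n m p =
      ∑ ω : Fin m → Fin n → Bool, (∏ j, vecWeight p (ω j)) * (minCount n m ω : ℝ) := by
  rw [expMin, integral_fintype .of_finite]
  simp [hyperMeasure_real_singleton hp0 hp1]

lemma sum_prod_vecWeight (p : ℝ) (n m : ℕ) :
    ∑ ω : Fin m → Fin n → Bool, ∏ j, vecWeight p (ω j) = 1 := by
  rw [← Fintype.prod_sum]
  simp [sum_vecWeight]

/-- A random set is contained in the set encoded by `x` with probability `(1 - p) ^ (n - |x|)`. -/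
lemma sum_vecWeight_subset (p : ℝ) {n : ℕ} (x : Fin n → Bool) :
    ∑ y : Fin n → Bool, (if toSet y ⊆ toSet x then vecWeight p y else 0) =
      (1 - p) ^ (n - (toSet x).card) := by
  have h (y : Fin n → Bool) : (if toSet y ⊆ toSet x then vecWeight p y else 0) =
      ∏ i, (if y i = true → x i = true then bernoulliWeight p (y i) else 0) := by
    rw [Finset.prod_ite_zero]
    simp [vecWeight, toSet, Finset.subset_iff]
  simp_rw [h]
  rw [← Fintype.prod_sum (fun i b => if b = true → x i = true then bernoulliWeight p b else 0)]
  have h' (i : Fin n) :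
      ∑ b : Bool, (if b = true → x i = true then bernoulliWeight p b else 0) =
        if i ∈ toSet x then 1 else 1 - p := by
    by_cases hx : x i = true <;> simp [bernoulliWeight, toSet, hx]
  simp_rw [h']
  rw [Finset.prod_ite]
  simp only [Finset.prod_const_one, one_mul, Finset.prod_const]
  congr 1
  rw [← Finset.compl_filter, Finset.card_compl]
  simp

lemma centredSize_eq (p : ℝ) {n : ℕ} (x : Fin n → Bool) :
    centredSize p x = (toSet x).card - p * n := by
  simp [centredSize, toSet, Finset.sum_sub_distrib, mul_comm]

lemma sum_vecWeight_succ (p : ℝ) (n : ℕ) (g : ℝ → ℝ) :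
    ∑ x : Fin (n + 1) → Bool, vecWeight p x * g (centredSize p x) =
      p * ∑ x : Fin n → Bool, vecWeight p x * g (1 - p + centredSize p x) +
      (1 - p) * ∑ x : Fin n → Bool, vecWeight p x * g (-p + centredSize p x) := by
  rw [← (Fin.consEquiv fun _ => Bool).sum_comp, Fintype.sum_prod_type]
  simp [vecWeight, centredSize, Fin.prod_univ_succ, Fin.sum_univ_succ, bernoulliWeight,
    Finset.mul_sum, mul_assoc, -Finset.sum_sub_distrib]

lemma sum_vecWeight_quartic (p : ℝ) (n : ℕ) : ∀ a b c d e : ℝ,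
    ∑ x : Fin n → Bool, vecWeight p x * (a + b * centredSize p x + c * centredSize p x ^ 2 +
        d * centredSize p x ^ 3 + e * centredSize p x ^ 4) =
      a + c * (n * (p * (1 - p))) + d * (n * (p * (1 - p) * (1 - 2 * p))) +
        e * (n * (p * (1 - p) * (1 - 3 * (p * (1 - p)))) +
          3 * n * (n - 1) * (p * (1 - p)) ^ 2) := by
  induction n with
  | zero => intro a b c d e; simp [vecWeight, centredSize]
  | succ n ih =>
    intro a b c d e
    rw [sum_vecWeight_succ p n fun z => a + b * z + c * z ^ 2 + d * z ^ 3 + e * z ^ 4]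
    have shift (t z : ℝ) : a + b * (t + z) + c * (t + z) ^ 2 + d * (t + z) ^ 3 + e * (t + z) ^ 4 =
        (a + b * t + c * t ^ 2 + d * t ^ 3 + e * t ^ 4) +
        (b + 2 * c * t + 3 * d * t ^ 2 + 4 * e * t ^ 3) * z +
        (c + 3 * d * t + 6 * e * t ^ 2) * z ^ 2 + (d + 4 * e * t) * z ^ 3 + e * z ^ 4 := by
      ring
    simp only [shift, ih]
    push_cast
    ring

/-- A quartic test function, positive only on the negative half-line and bounded above. -/
lemma quartic_le_indicator {K : ℝ} (hK : 1 ≤ K) (w : ℝ) :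
    -(2 * K) * w + w ^ 2 - w ^ 4 / (2 * K) ≤ if w ≤ 0 then K ^ 2 + 2 * K else 0 := by
  have hK0 : 0 < 2 * K := by linarith
  split_ifs with hw
  · have h : 2 * w ^ 2 ≤ w ^ 4 / (2 * K) + 2 * K := by
      rw [← sub_nonneg]
      have : w ^ 4 / (2 * K) + 2 * K - 2 * w ^ 2 = (w ^ 2 - 2 * K) ^ 2 / (2 * K) := by
        field_simp
        ring
      rw [this]
      positivity
    nlinarith [sq_nonneg (w + K)]
  · push Not at hw
    rcases le_total w (2 * K) with h | h
    · have : 0 ≤ w ^ 4 / (2 * K) := by positivity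
      nlinarith
    · have : w ^ 2 ≤ w ^ 4 / (2 * K) := by
        rw [le_div_iff₀ hK0]
        have h2 : 2 * K ≤ w ^ 2 := by nlinarith
        nlinarith [sq_nonneg w]
      nlinarith

/-- A binomial variable is at most its mean with probability bounded away from zero. -/
lemma binomial_le_mean (hp0 : 0 < p) (hp1 : p < 1) :
    ∃ c > (0 : ℝ), ∀ n : ℕ, 0 < n →
      c ≤ ∑ x : Fin n → Bool, (if ((toSet x).card : ℝ) ≤ p * n then vecWeight p x else 0) := by
  set v := p * (1 - p) with hv
  have hv0 : 0 < v := mul_pos hp0 (by linarith)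
  set K := 3 + 1 / v with hKdef
  have hK : 1 ≤ K := by
    have : 0 < 1 / v := by positivity
    linarith
  have hK0 : 0 < K := by linarith
  refine ⟨1 / 2 / (K ^ 2 + 2 * K), by positivity, fun n hn => ?_⟩
  have hn1 : (1 : ℝ) ≤ n := by exact_mod_cast hn
  set s := √(n * v) with hs
  have hs2 : s ^ 2 = n * v := Real.sq_sqrt (by positivity)
  have hs0 : 0 < s := Real.sqrt_pos.2 (by positivity)
  have hmom := sum_vecWeight_quartic p n 0 (-(2 * K) / s) (1 / s ^ 2) 0 (-(1 / (2 * K * s ^ 4)))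
  rw [← hv] at hmom
  have hfourth : n * (v * (1 - 3 * v)) + 3 * n * (n - 1) * v ^ 2 ≤ K * s ^ 4 := by
    have h4 : s ^ 4 = (n * v) ^ 2 := by rw [← hs2]; ring
    have : K * (n * v) ^ 2 = 3 * (n * v) ^ 2 + n ^ 2 * v := by
      rw [hKdef]; field_simp
    rw [h4, this]
    nlinarith [mul_pos hv0 hv0, mul_nonneg (mul_nonneg (by linarith : (0 : ℝ) ≤ n) hv0.le)
      (by linarith : (0 : ℝ) ≤ n - 1), mul_nonneg (by linarith : (0 : ℝ) ≤ n) (sq_nonneg v)]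
  have hhalf : 1 / (2 * K * s ^ 4) * (n * (v * (1 - 3 * v)) + 3 * n * (n - 1) * v ^ 2) ≤ 1 / 2 := by
    calc _ ≤ 1 / (2 * K * s ^ 4) * (K * s ^ 4) := by gcongr
      _ = 1 / 2 := by field_simp
  have hone : 1 / s ^ 2 * (n * v) = 1 := by rw [← hs2]; field_simp
  rw [div_le_iff₀ (by positivity), Finset.sum_mul]
  refine le_trans (by rw [hone]; linarith) (hmom.symm.le.trans (Finset.sum_le_sum fun x _ => ?_))
  have hq := quartic_le_indicator hK (centredSize p x / s)
  have hiff : centredSize p x / s ≤ 0 ↔ ((toSet x).card : ℝ) ≤ p * n := by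
    rw [div_le_iff₀ hs0, zero_mul, centredSize_eq, sub_nonpos]
  simp only [hiff] at hq
  have hpoly : 0 + -(2 * K) / s * centredSize p x + 1 / s ^ 2 * centredSize p x ^ 2 +
      0 * centredSize p x ^ 3 + -(1 / (2 * K * s ^ 4)) * centredSize p x ^ 4 =
      -(2 * K) * (centredSize p x / s) + (centredSize p x / s) ^ 2 -
        (centredSize p x / s) ^ 4 / (2 * K) := by
    field_simp
    ring
  rw [hpoly]
  have := mul_le_mul_of_nonneg_left hq (vecWeight_nonneg hp0.le hp1.le x)
  split_ifs at this ⊢ <;> simpa using this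

lemma exp_neg_one_le_one_sub_pow {m : ℕ} (hm : 0 < m) {b : ℝ} (hb : m * b ≤ 1) :
    Real.exp (-1) ≤ (1 - b) ^ (m - 1) := by
  obtain ⟨k, rfl⟩ : ∃ k, m = k + 1 := ⟨m - 1, by omega⟩
  rw [Nat.add_sub_cancel]
  rcases Nat.eq_zero_or_pos k with rfl | hk
  · simp
  have hk0 : (0 : ℝ) < k := by exact_mod_cast hk
  push_cast at hb
  have h1 : Real.exp (-(1 / k)) ≤ 1 - b := by
    rw [Real.exp_neg, inv_le_comm₀ (Real.exp_pos _) (by nlinarith)]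
    have h2 : (1 - b)⁻¹ ≤ 1 / k + 1 := by
      rw [inv_le_iff_one_le_mul₀ (by nlinarith)]
      have : (1 / k + 1) * (1 - b) = (k + 1) * (1 - b) / k := by field_simp; ring
      rw [this, le_div_iff₀ hk0]
      linarith
    exact h2.trans (Real.add_one_le_exp _)
  calc Real.exp (-1) = Real.exp (-(1 / k)) ^ k := by
        rw [← Real.exp_nat_mul]; congr 1; field_simp
    _ ≤ _ := pow_le_pow_left₀ (Real.exp_pos _).le h1 _

end Weights

lemma minCount_le {n m : ℕ} (ω : Fin m → Fin n → Bool) : minCount n m ω ≤ m := by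
  classical
  calc minCount n m ω ≤ (Finset.univ.image fun j => toSet (ω j)).card := by
        refine Finset.card_le_card fun S hS => ?_
        obtain ⟨j, hj⟩ := (Finset.mem_filter.1 hS).2.1
        exact Finset.mem_image.2 ⟨j, Finset.mem_univ _, hj⟩
    _ ≤ m := Finset.card_image_le.trans (by simp)

/-- The indices whose edge contains no other edge inject into the minimal edges. -/
lemma card_isolated_le_minCount {n m : ℕ} (ω : Fin m → Fin n → Bool) :
    (Finset.univ.filter fun j => ∀ k, k ≠ j → ¬ toSet (ω k) ⊆ toSet (ω j)).card ≤
      minCount n m ω := by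
  refine Finset.card_le_card_of_injOn (fun j => toSet (ω j)) (fun j hj => ?_)
    fun j hj k hk hjk => ?_
  · have hj' := (Finset.mem_filter.1 hj).2
    refine Finset.mem_coe.2 (Finset.mem_filter.2 ⟨Finset.mem_univ _, ⟨j, rfl⟩, fun k hk => ?_⟩)
    rcases eq_or_ne k j with rfl | hne
    · exact hk.ne rfl
    · exact hj' k hne hk.subset
  · by_contra hne
    have hk' := (Finset.mem_filter.1 hk).2
    exact hk' j hne hjk.subset

/-- The probability that the edge with index `j` contains no other edge. -/
lemma sum_isolated (p : ℝ) {n m : ℕ} (j : Fin m) :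
    ∑ ω : Fin m → Fin n → Bool, (∏ k, vecWeight p (ω k)) *
        (if ∀ k, k ≠ j → ¬ toSet (ω k) ⊆ toSet (ω j) then 1 else 0) =
      ∑ x : Fin n → Bool, vecWeight p x * (1 - (1 - p) ^ (n - (toSet x).card)) ^ (m - 1) := by
  classical
  let F (x : Fin n → Bool) (k : Fin m) (y : Fin n → Bool) : ℝ :=
    if k = j then (if y = x then vecWeight p y else 0)
    else (if ¬ toSet y ⊆ toSet x then vecWeight p y else 0)
  have hF (x : Fin n → Bool) : ∑ ω : Fin m → Fin n → Bool, ∏ k, F x k (ω k) =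
      vecWeight p x * (1 - (1 - p) ^ (n - (toSet x).card)) ^ (m - 1) := by
    rw [← Fintype.prod_sum, ← Finset.mul_prod_erase _ _ (Finset.mem_univ j)]
    congr 1
    · simp [F]
    · rw [Finset.prod_congr rfl (g := fun _ => 1 - (1 - p) ^ (n - (toSet x).card))]
      · simp
      · intro k hk
        simp only [F, Finset.ne_of_mem_erase hk, if_false]
        rw [← sum_vecWeight_subset p x, ← sum_vecWeight p n, ← Finset.sum_sub_distrib]
        refine Finset.sum_congr rfl fun y _ => ?_
        split_ifs <;> simp_all
  simp_rw [← hF]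
  rw [Finset.sum_comm]
  refine Finset.sum_congr rfl fun ω _ => ?_
  rw [Finset.sum_eq_single (ω j)]
  · have hprod (k : Fin m) : F (ω j) k (ω k) =
        if k ≠ j → ¬ toSet (ω k) ⊆ toSet (ω j) then vecWeight p (ω k) else 0 := by
      by_cases hk : k = j
      · subst hk; simp [F]
      · simp [F, hk]
    simp_rw [hprod]
    rw [Finset.prod_ite_zero]
    simp
  · intro x _ hx
    exact Finset.prod_eq_zero (Finset.mem_univ j) (by simp [F, hx.symm])
  · simp

lemma expMin_le {p : ℝ} (hp0 : 0 ≤ p) (hp1 : p ≤ 1) (n m : ℕ) : expMin n m p ≤ m := by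
  rw [expMin_eq_sum hp0 hp1, ← one_mul (m : ℝ), ← sum_prod_vecWeight p n m, Finset.sum_mul]
  refine Finset.sum_le_sum fun ω _ => mul_le_mul_of_nonneg_left ?_
    (Finset.prod_nonneg fun _ _ => vecWeight_nonneg hp0 hp1 _)
  exact_mod_cast minCount_le ω

lemma le_expMin {p : ℝ} (hp0 : 0 ≤ p) (hp1 : p ≤ 1) (n m : ℕ) :
    m * ∑ x : Fin n → Bool, vecWeight p x * (1 - (1 - p) ^ (n - (toSet x).card)) ^ (m - 1) ≤
      expMin n m p := by
  have h : (m : ℝ) * ∑ x : Fin n → Bool,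
      vecWeight p x * (1 - (1 - p) ^ (n - (toSet x).card)) ^ (m - 1) =
      ∑ j : Fin m, ∑ ω : Fin m → Fin n → Bool, (∏ k, vecWeight p (ω k)) *
        (if ∀ k, k ≠ j → ¬ toSet (ω k) ⊆ toSet (ω j) then 1 else 0) := by
    simp only [sum_isolated]
    simp
  rw [h, expMin_eq_sum hp0 hp1, Finset.sum_comm]
  refine Finset.sum_le_sum fun ω _ => ?_
  rw [← Finset.mul_sum]
  refine mul_le_mul_of_nonneg_left ?_
    (Finset.prod_nonneg fun _ _ => vecWeight_nonneg hp0 hp1 _)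
  rw [Finset.sum_boole]
  exact_mod_cast card_isolated_le_minCount ω

/-- **Linear regime.** For `m ≤ 1/(1-p)^{(1-p)n}`, the expected number of minimal
edges of `B_{n,m,p}` is `Θ(m)`: there is a constant `c > 0` depending only on `p`
with `c·m ≤ E[|min(B_{n,m,p})|] ≤ m`. -/
theorem linear_regime (p : ℝ) (hp0 : 0 < p) (hp1 : p < 1) :
    ∃ c > (0 : ℝ), ∀ n m : ℕ, 0 < n → 0 < m →
      (m : ℝ) ≤ 1 / (1 - p) ^ ((1 - p) * n) →
      c * m ≤ expMin n m p ∧ expMin n m p ≤ m := by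
  obtain ⟨c, hc, hbin⟩ := binomial_le_mean hp0 hp1
  refine ⟨c * Real.exp (-1), mul_pos hc (Real.exp_pos _), fun n m hn hm hmn =>
    ⟨le_trans ?_ (le_expMin hp0.le hp1.le n m), expMin_le hp0.le hp1.le n m⟩⟩
  have hq0 : 0 < 1 - p := by linarith
  rw [mul_comm _ (m : ℝ)]
  refine mul_le_mul_of_nonneg_left ?_ (Nat.cast_nonneg m)
  refine (mul_le_mul_of_nonneg_right (hbin n hn) (Real.exp_pos _).le).trans ?_
  rw [Finset.sum_mul]
  refine Finset.sum_le_sum fun x _ => ?_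
  have hW := vecWeight_nonneg hp0.le hp1.le x
  split_ifs with hx
  · refine mul_le_mul_of_nonneg_left (exp_neg_one_le_one_sub_pow hm ?_) hW
    have hcard : (toSet x).card ≤ n := by simpa using (toSet x).card_le_univ
    have hle : (1 - p) ^ (n - (toSet x).card) ≤ (1 - p) ^ ((1 - p) * n) := by
      rw [← Real.rpow_natCast]
      refine Real.rpow_le_rpow_of_exponent_ge hq0 (by linarith) ?_
      rw [Nat.cast_sub hcard]
      linarith
    rw [le_div_iff₀ (Real.rpow_pos_of_pos hq0 _)] at hmn
    exact (mul_le_mul_of_nonneg_left hle (Nat.cast_nonneg m)).trans hmn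
  · rw [zero_mul]
    refine mul_nonneg hW (pow_nonneg (sub_nonneg.2 (pow_le_one₀ hq0.le (by linarith))) _)
end

section
/- Let 0 < p < 1 be a probability and ε, ε' > 0 positive reals. There exists a constant C > 0 depending only on p, ε, ε' such that for all positive integers n and m with 1/(1-p)^{(1-p+ε)n} ≤ m ≤ 1/(1-p)^{(1-ε')n}, setting α = -(log m)/(n·log(1-p)), the expected number of minimal edges satisfies E[|min(B_{n,m,p})|] ≤ C · 2^{(Hb(α) + (1-α)·log₂ p)·n} / √n. -/
open MeasureTheory

/-- The binary entropy function. -/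
noncomputable def binEnt (x : ℝ) : ℝ :=
  -(x * Real.logb 2 x) - (1 - x) * Real.logb 2 (1 - x)

theorem factorial_le_stirling {n : ℕ} (hn : 0 < n) :
    (n.factorial : ℝ) ≤ Real.exp 1 * √n * (n / Real.exp 1) ^ n := by
  obtain ⟨k, rfl⟩ := Nat.exists_eq_succ_of_ne_zero hn.ne'
  have h := Stirling.stirlingSeq'_antitone (Nat.zero_le k)
  simp only [Function.comp, Stirling.stirlingSeq_one] at h
  rw [Stirling.stirlingSeq, div_le_iff₀ (by positivity)] at h
  refine h.trans (le_of_eq ?_)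
  rw [show √(2 * ((k.succ : ℕ) : ℝ)) = √2 * √(k.succ : ℕ) from Real.sqrt_mul (by norm_num) _]
  field_simp

theorem choose_add_mul_factorial_mul_factorial (i j : ℕ) :
    (i + j).choose i * i.factorial * j.factorial = (i + j).factorial := by
  rw [Nat.choose_symm_add, Nat.add_choose_mul_factorial_mul_factorial]

theorem pow_mul_pow_mul_add_pow_le {x y : ℝ} (hx : 0 < x) (hy : 0 < y) (hxy : x + y = 1)
    {i j : ℕ} (hi : 0 < i) (hj : 0 < j) :
    x ^ i * y ^ j * ((i : ℝ) + j) ^ (i + j) ≤ (i : ℝ) ^ i * (j : ℝ) ^ j := by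
  have hi' : (0 : ℝ) < i := by exact_mod_cast hi
  have hj' : (0 : ℝ) < j := by exact_mod_cast hj
  have key : ∀ {z : ℝ} {k : ℕ}, 0 < z → (0 : ℝ) < k →
      (z * ((i : ℝ) + j)) ^ k ≤ (k : ℝ) ^ k * Real.exp (z * (i + j) - k) := by
    intro z k hz hk
    have h1 : z * ((i : ℝ) + j) ≤ k * Real.exp (z * (i + j) / k - 1) := by
      have := Real.add_one_le_exp (z * ((i : ℝ) + j) / k - 1)
      rw [sub_add_cancel, div_le_iff₀ hk] at this
      linarith
    calc (z * ((i : ℝ) + j)) ^ k ≤ (k * Real.exp (z * (i + j) / k - 1)) ^ k := by gcongr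
      _ = _ := by
        rw [mul_pow, ← Real.exp_nat_mul]
        congr 2
        field_simp
  calc x ^ i * y ^ j * ((i : ℝ) + j) ^ (i + j)
      = (x * ((i : ℝ) + j)) ^ i * (y * ((i : ℝ) + j)) ^ j := by
        rw [mul_pow, mul_pow, pow_add]; ring
    _ ≤ ((i : ℝ) ^ i * Real.exp (x * (i + j) - i)) * ((j : ℝ) ^ j * Real.exp (y * (i + j) - j)) := by
        gcongr
        · exact key hx hi'
        · exact key hy hj'
    _ = (i : ℝ) ^ i * (j : ℝ) ^ j * Real.exp (x * (i + j) - i + (y * (i + j) - j)) := by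
        rw [Real.exp_add]; ring
    _ = _ := by
        rw [show x * ((i : ℝ) + j) - i + (y * (i + j) - j) = 0 by
          linear_combination ((i : ℝ) + j) * hxy]
        simp

theorem choose_mul_pow_mul_sqrt_le {x y : ℝ} (hx : 0 < x) (hy : 0 < y) (hxy : x + y = 1)
    {i j : ℕ} (hi : 0 < i) (hj : 0 < j) :
    ((i + j).choose i : ℝ) * x ^ i * y ^ j * √((i : ℝ) * j) ≤ √((i : ℝ) + j) := by
  have hi' : (0 : ℝ) < i := by exact_mod_cast hi
  have hj' : (0 : ℝ) < j := by exact_mod_cast hj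
  have hfac : ((i + j).choose i : ℝ) * i.factorial * j.factorial = (i + j).factorial := by
    exact_mod_cast choose_add_mul_factorial_mul_factorial i j
  have hup := factorial_le_stirling (n := i + j) (by omega)
  have hli := Stirling.le_factorial_stirling i
  have hlj := Stirling.le_factorial_stirling j
  have hep : Real.exp 1 ≤ 2 * Real.pi := by
    have := Real.exp_one_lt_d9
    have := Real.pi_gt_three
    linarith
  set c : ℝ := ((i + j).choose i : ℝ)
  have hc : 0 ≤ c := Nat.cast_nonneg _
  set e := Real.exp 1
  have he : 0 < e := Real.exp_pos 1
  have hsq : √(2 * Real.pi * i) * √(2 * Real.pi * j) = 2 * Real.pi * √((i : ℝ) * j) := by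
    rw [← Real.sqrt_mul (by positivity), show 2 * Real.pi * i * (2 * Real.pi * j)
      = (2 * Real.pi) ^ 2 * ((i : ℝ) * j) by ring, Real.sqrt_mul (by positivity),
      Real.sqrt_sq (by positivity)]
  push_cast at hup
  have h1 : c * (2 * Real.pi * √((i : ℝ) * j)) * ((i : ℝ) ^ i * (j : ℝ) ^ j)
      ≤ e * √((i : ℝ) + j) * ((i : ℝ) + j) ^ (i + j) := by
    have : c * (√(2 * Real.pi * i) * (i / e) ^ i) * (√(2 * Real.pi * j) * (j / e) ^ j)
        ≤ e * √((i : ℝ) + j) * (((i : ℝ) + j) / e) ^ (i + j) := by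
      refine le_trans ?_ hup
      rw [← hfac]
      gcongr
    rw [← hsq]
    rw [div_pow, div_pow, div_pow] at this
    have h2 := mul_le_mul_of_nonneg_right this (pow_pos he (i + j)).le
    refine le_trans (le_of_eq ?_) (h2.trans (le_of_eq ?_))
    · field_simp
      rw [pow_add]
      ring
    · field_simp
  have h2 := pow_mul_pow_mul_add_pow_le hx hy hxy hi hj
  have hN : 0 < ((i : ℝ) + j) ^ (i + j) := by positivity
  have h3 : (c * x ^ i * y ^ j * √((i : ℝ) * j)) * (e * ((i : ℝ) + j) ^ (i + j))
      ≤ √((i : ℝ) + j) * (e * ((i : ℝ) + j) ^ (i + j)) := by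
    calc _ = c * (e * √((i : ℝ) * j)) * (x ^ i * y ^ j * ((i : ℝ) + j) ^ (i + j)) := by ring
      _ ≤ c * (2 * Real.pi * √((i : ℝ) * j)) * ((i : ℝ) ^ i * (j : ℝ) ^ j) := by gcongr
      _ ≤ _ := h1
      _ = _ := by ring
  exact le_of_mul_le_mul_right h3 (by positivity)

theorem choose_mul_pow_mul_pow_le {x y : ℝ} (hx : 0 < x) (hy : 0 < y) (hxy : x + y = 1)
    {i j : ℕ} (hij : 0 < i + j) :
    ((i + j).choose i : ℝ) * x ^ i * y ^ j ≤ 1 / (x * y * √((i : ℝ) + j)) := by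
  have h := choose_mul_pow_mul_sqrt_le hx hy hxy (Nat.succ_pos i) (Nat.succ_pos j)
  have hnat : (i + j).choose i * ((i + j + 1) * (i + j + 2))
      = (i + 1 + (j + 1)).choose (i + 1) * ((i + 1) * (j + 1)) := by
    have h1 := choose_add_mul_factorial_mul_factorial i j
    have h2 := choose_add_mul_factorial_mul_factorial (i + 1) (j + 1)
    have h3 : (i + 1 + (j + 1)).factorial = (i + j + 2) * ((i + j + 1) * (i + j).factorial) := by
      rw [show i + 1 + (j + 1) = i + j + 1 + 1 by ring, Nat.factorial_succ, Nat.factorial_succ]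
    rw [h3, ← h1, Nat.factorial_succ, Nat.factorial_succ] at h2
    have hp : 0 < i.factorial * j.factorial := by positivity
    apply Nat.eq_of_mul_eq_mul_right hp
    linear_combination h2.symm
  have hreal : ((i + j).choose i : ℝ) * (((i : ℝ) + j + 1) * (i + j + 2))
      = ((i + 1 + (j + 1)).choose (i + 1) : ℝ) * (((i : ℝ) + 1) * (j + 1)) := by
    exact_mod_cast hnat
  simp only [Nat.succ_eq_add_one] at h
  push_cast at h
  set c : ℝ := ((i + j).choose i : ℝ)
  set c' : ℝ := ((i + 1 + (j + 1)).choose (i + 1) : ℝ)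
  have hn : (0 : ℝ) < (i : ℝ) + j := by exact_mod_cast hij
  set s := √(((i : ℝ) + 1) * (j + 1)) with hs
  set t := √((i : ℝ) + 1 + (j + 1)) with ht
  have hs2 : s ^ 2 = ((i : ℝ) + 1) * (j + 1) := Real.sq_sqrt (by positivity)
  have ht2 : t ^ 2 = (i : ℝ) + 1 + (j + 1) := Real.sq_sqrt (by positivity)
  have hs0 : 0 < s := Real.sqrt_pos.2 (by positivity)
  have ht0 : 0 < t := Real.sqrt_pos.2 (by positivity)
  have hst : s ≤ (i : ℝ) + j + 1 := by
    refine Real.sqrt_le_iff.2 ⟨by positivity, ?_⟩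
    nlinarith [(Nat.cast_nonneg i : (0 : ℝ) ≤ i), (Nat.cast_nonneg j : (0 : ℝ) ≤ j)]
  have htn : √((i : ℝ) + j) ≤ t := Real.sqrt_le_sqrt (by linarith)
  have hmain : (c * x ^ i * y ^ j * (x * y * t)) * (((i : ℝ) + j + 1) * t)
      ≤ 1 * (((i : ℝ) + j + 1) * t) := by
    calc _ = (c * (((i : ℝ) + j + 1) * t ^ 2)) * (x ^ (i + 1) * y ^ (j + 1)) := by ring
      _ = (c * (((i : ℝ) + j + 1) * (i + j + 2))) * (x ^ (i + 1) * y ^ (j + 1)) := by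
          rw [ht2]; ring
      _ = (c' * x ^ (i + 1) * y ^ (j + 1) * s) * s := by rw [hreal, ← hs2]; ring
      _ ≤ t * ((i : ℝ) + j + 1) := by gcongr
      _ = _ := by ring
  have h4 := le_of_mul_le_mul_right hmain (by positivity)
  rw [le_div_iff₀ (by positivity)]
  refine le_trans ?_ h4
  gcongr

theorem sum_pow_dist_le {s : ℝ} (hs0 : 0 < s) (hs1 : s < 1) (f N : ℕ) :
    ∑ k ∈ Finset.range N, s ^ (Nat.dist f k) ≤ 2 / (1 - s) := by
  have hg : ∀ M : ℕ, ∑ k ∈ Finset.range M, s ^ k ≤ 1 / (1 - s) := by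
    intro M
    rw [one_div, ← tsum_geometric_of_lt_one hs0.le hs1]
    exact (summable_geometric_of_lt_one hs0.le hs1).sum_le_tsum _ (fun _ _ => by positivity)
  calc ∑ k ∈ Finset.range N, s ^ (Nat.dist f k)
      ≤ ∑ k ∈ Finset.range (f + 1 + N), s ^ (Nat.dist f k) :=
        Finset.sum_le_sum_of_subset_of_nonneg (Finset.range_mono (by omega))
          (fun _ _ _ => by positivity)
    _ = ∑ k ∈ Finset.range (f + 1), s ^ (Nat.dist f k)
        + ∑ k ∈ Finset.range N, s ^ (Nat.dist f (f + 1 + k)) := Finset.sum_range_add _ _ _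
    _ ≤ ∑ k ∈ Finset.range (f + 1), s ^ k + ∑ k ∈ Finset.range N, s ^ k := by
        refine add_le_add (le_of_eq ?_) (Finset.sum_le_sum fun k _ => ?_)
        · rw [← Finset.sum_range_reflect]
          refine Finset.sum_congr rfl fun k hk => ?_
          have := Finset.mem_range.1 hk
          congr 1
          unfold Nat.dist
          omega
        · refine pow_le_pow_of_le_one hs0.le hs1.le ?_
          unfold Nat.dist
          omega
    _ ≤ 1 / (1 - s) + 1 / (1 - s) := add_le_add (hg _) (hg _)
    _ = 2 / (1 - s) := by ring

theorem sum_rpow_abs_sub_le {s : ℝ} (hs0 : 0 < s) (hs1 : s < 1) {a : ℝ} (ha : 0 ≤ a) (N : ℕ) :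
    ∑ k ∈ Finset.range N, s ^ |a - k| ≤ 2 / (s * (1 - s)) := by
  have h : ∀ k : ℕ, s ^ |a - k| ≤ s⁻¹ * s ^ (Nat.dist ⌊a⌋₊ k) := by
    intro k
    have h1 : ((Nat.dist ⌊a⌋₊ k : ℕ) : ℝ) - 1 ≤ |a - k| := by
      have h2 := Nat.floor_le ha
      have h3 := Nat.lt_floor_add_one a
      rcases le_total ⌊a⌋₊ k with h | h
      · rw [Nat.dist_eq_sub_of_le h, Nat.cast_sub h]
        have := neg_abs_le (a - k)
        linarith
      · rw [Nat.dist_eq_sub_of_le_right h, Nat.cast_sub h]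
        have := le_abs_self (a - k)
        linarith
    refine (Real.rpow_le_rpow_of_exponent_ge hs0 hs1.le h1).trans (le_of_eq ?_)
    rw [Real.rpow_sub hs0, Real.rpow_natCast, Real.rpow_one]
    ring
  calc _ ≤ ∑ k ∈ Finset.range N, s⁻¹ * s ^ (Nat.dist ⌊a⌋₊ k) := Finset.sum_le_sum fun k _ => h k
    _ ≤ s⁻¹ * (2 / (1 - s)) := by
        rw [← Finset.mul_sum]
        exact mul_le_mul_of_nonneg_left (sum_pow_dist_le hs0 hs1 _ _) (by positivity)
    _ = _ := by field_simp

theorem toSet_eq_iff {n : ℕ} (f : Fin n → Bool) (S : Finset (Fin n)) :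
    toSet f = S ↔ ∀ i, f i = decide (i ∈ S) := by
  simp only [toSet, Finset.ext_iff, Finset.mem_filter, Finset.mem_univ, true_and]
  refine forall_congr' fun i => ?_
  by_cases h : i ∈ S <;> simp [h]

theorem toSet_subset_iff {n : ℕ} (f : Fin n → Bool) (S : Finset (Fin n)) :
    toSet f ⊆ S ↔ ∀ i, i ∉ S → f i = false := by
  simp only [toSet, Finset.subset_iff, Finset.mem_filter, Finset.mem_univ, true_and]
  refine forall_congr' fun i => ?_
  by_cases h : i ∈ S <;> simp [h]

section

variable {p : ℝ}

theorem bernoulliBool_real_true (hp0 : 0 ≤ p) : (bernoulliBool p).real {true} = p := by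
  simp [bernoulliBool, measureReal_def, hp0]

theorem bernoulliBool_real_false (hp1 : p ≤ 1) : (bernoulliBool p).real {false} = 1 - p := by
  simp [bernoulliBool, measureReal_def, hp1]

theorem isProbabilityMeasure_bernoulliBool (hp0 : 0 ≤ p) (hp1 : p ≤ 1) :
    IsProbabilityMeasure (bernoulliBool p) := by
  constructor
  simp only [bernoulliBool, Measure.add_apply, Measure.smul_apply, measure_univ, smul_eq_mul,
    mul_one]
  rw [← ENNReal.ofReal_add hp0 (by linarith)]
  simp

theorem pi_real_univ_pi {ι : Type*} [Fintype ι] {α : ι → Type*} [∀ i, MeasurableSpace (α i)]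
    (μ : ∀ i, Measure (α i)) [∀ i, SigmaFinite (μ i)] (s : ∀ i, Set (α i)) :
    (Measure.pi μ).real (Set.univ.pi s) = ∏ i, (μ i).real (s i) := by
  simp only [measureReal_def, Measure.pi_pi, ENNReal.toReal_prod]

theorem prod_ite_mem_const {ι : Type*} [Fintype ι] [DecidableEq ι] (S : Finset ι) (a b : ℝ) :
    ∏ i, (if i ∈ S then a else b) = a ^ S.card * b ^ (Fintype.card ι - S.card) := by
  rw [Finset.prod_ite, Finset.prod_const, Finset.prod_const]
  congr 2
  · simp
  · rw [← Finset.card_compl]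
    congr 1
    ext i
    simp

theorem pi_bernoulliBool_real_toSet_eq (hp0 : 0 ≤ p) (hp1 : p ≤ 1) {n : ℕ}
    (S : Finset (Fin n)) :
    (Measure.pi fun _ : Fin n => bernoulliBool p).real {f | toSet f = S}
      = p ^ S.card * (1 - p) ^ (n - S.card) := by
  have h : {f : Fin n → Bool | toSet f = S} = Set.univ.pi fun i => {decide (i ∈ S)} := by
    ext f
    simp [toSet_eq_iff]
  rw [h, pi_real_univ_pi]
  have := prod_ite_mem_const S p (1 - p)
  rw [Fintype.card_fin] at this
  rw [← this]
  refine Finset.prod_congr rfl fun i _ => ?_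
  by_cases hi : i ∈ S
  · simp [hi, bernoulliBool_real_true hp0]
  · simp [hi, bernoulliBool_real_false hp1]

theorem pi_bernoulliBool_real_toSet_subset (hp0 : 0 ≤ p) (hp1 : p ≤ 1) {n : ℕ}
    (S : Finset (Fin n)) :
    (Measure.pi fun _ : Fin n => bernoulliBool p).real {f | toSet f ⊆ S}
      = (1 - p) ^ (n - S.card) := by
  have := isProbabilityMeasure_bernoulliBool hp0 hp1
  have h : {f : Fin n → Bool | toSet f ⊆ S}
      = Set.univ.pi fun i => if i ∈ S then Set.univ else {false} := by
    ext f
    simp only [Set.mem_ofPred_eq, toSet_subset_iff, Set.mem_univ_pi]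
    refine forall_congr' fun i => ?_
    by_cases hi : i ∈ S <;> simp [hi]
  rw [h, pi_real_univ_pi]
  have := prod_ite_mem_const S 1 (1 - p)
  rw [Fintype.card_fin, one_pow, one_mul] at this
  rw [← this]
  refine Finset.prod_congr rfl fun i _ => ?_
  by_cases hi : i ∈ S
  · rw [if_pos hi, if_pos hi, probReal_univ]
  · simp [hi, bernoulliBool_real_false hp1]

theorem pi_bernoulliBool_real_not_toSet_ssubset (hp0 : 0 ≤ p) (hp1 : p ≤ 1) {n : ℕ}
    (S : Finset (Fin n)) :
    (Measure.pi fun _ : Fin n => bernoulliBool p).real {f | ¬ toSet f ⊂ S}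
      = 1 - (1 - p) ^ (n - S.card) * (1 - p ^ S.card) := by
  have := isProbabilityMeasure_bernoulliBool hp0 hp1
  have h : {f : Fin n → Bool | ¬ toSet f ⊂ S}
      = ({f | toSet f ⊆ S} \ {f | toSet f = S})ᶜ := by
    ext f
    simp only [Set.mem_ofPred_eq, Set.mem_compl_iff, Set.mem_sdiff, ssubset_iff_subset_ne, ne_eq]
  have hsub : {f : Fin n → Bool | toSet f = S} ⊆ {f | toSet f ⊆ S} := fun f hf => Eq.subset hf
  rw [h, measureReal_compl (Set.toFinite _).measurableSet,
    measureReal_sdiff hsub (Set.toFinite _).measurableSet,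
    pi_bernoulliBool_real_toSet_eq hp0 hp1, pi_bernoulliBool_real_toSet_subset hp0 hp1]
  simp
  ring

theorem hyperMeasure_real_eq_and_not_ssubset (hp0 : 0 ≤ p) (hp1 : p ≤ 1) {n m : ℕ}
    (S : Finset (Fin n)) (j : Fin m) :
    (hyperMeasure n m p).real {ω | toSet (ω j) = S ∧ ∀ k, k ≠ j → ¬ toSet (ω k) ⊂ S}
      = p ^ S.card * (1 - p) ^ (n - S.card)
        * (1 - (1 - p) ^ (n - S.card) * (1 - p ^ S.card)) ^ (m - 1) := by
  have h : {ω : Fin m → Fin n → Bool | toSet (ω j) = S ∧ ∀ k, k ≠ j → ¬ toSet (ω k) ⊂ S}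
      = Set.univ.pi fun k => if k = j then {f | toSet f = S} else {f | ¬ toSet f ⊂ S} := by
    ext ω
    simp only [Set.mem_ofPred_eq, Set.mem_univ_pi]
    constructor
    · rintro ⟨h1, h2⟩ k
      by_cases hk : k = j
      · simpa [hk] using h1
      · simpa [hk] using h2 k hk
    · intro h
      refine ⟨by simpa using h j, fun k hk => ?_⟩
      have := h k
      rwa [if_neg hk] at this
  rw [h, hyperMeasure, pi_real_univ_pi, ← Finset.mul_prod_erase _ _ (Finset.mem_univ j),
    if_pos rfl, pi_bernoulliBool_real_toSet_eq hp0 hp1]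
  congr 1
  rw [Finset.prod_congr rfl (g := fun _ =>
    1 - (1 - p) ^ (n - S.card) * (1 - p ^ S.card)), Finset.prod_const]
  · simp
  · intro k hk
    rw [if_neg (Finset.ne_of_mem_erase hk), pi_bernoulliBool_real_not_toSet_ssubset hp0 hp1]

theorem minCount_le_s2 {n m : ℕ} (ω : Fin m → Fin n → Bool) :
    (minCount n m ω : ℝ) ≤ ∑ S : Finset (Fin n), ∑ j : Fin m,
      Set.indicator {ω | toSet (ω j) = S ∧ ∀ k, k ≠ j → ¬ toSet (ω k) ⊂ S} (fun _ => 1) ω := by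
  classical
  rw [minCount, Finset.card_filter]
  push_cast
  refine Finset.sum_le_sum fun S _ => ?_
  have hnn : ∀ j ∈ (Finset.univ : Finset (Fin m)), (0 : ℝ) ≤ Set.indicator
      {ω : Fin m → Fin n → Bool | toSet (ω j) = S ∧ ∀ k, k ≠ j → ¬ toSet (ω k) ⊂ S}
      (fun _ => 1) ω := fun j _ => Set.indicator_nonneg (fun _ _ => zero_le_one) _
  split_ifs with h
  · obtain ⟨⟨j, hj⟩, hk⟩ := h
    refine le_trans (le_of_eq ?_) (Finset.single_le_sum hnn (Finset.mem_univ j))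
    rw [Set.indicator_of_mem]
    exact ⟨hj, fun k _ => hk k⟩
  · exact Finset.sum_nonneg hnn

theorem expMin_le_s2 (hp0 : 0 ≤ p) (hp1 : p ≤ 1) (n m : ℕ) :
    expMin n m p ≤ ∑ k ∈ Finset.range (n + 1), (n.choose k : ℝ) * (m * (p ^ k * (1 - p) ^ (n - k)
        * (1 - (1 - p) ^ (n - k) * (1 - p ^ k)) ^ (m - 1))) := by
  have := isProbabilityMeasure_bernoulliBool hp0 hp1
  have : IsFiniteMeasure (hyperMeasure n m p) := by
    unfold hyperMeasure
    infer_instance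
  calc expMin n m p ≤ ∫ ω, ∑ S : Finset (Fin n), ∑ j : Fin m,
      Set.indicator {ω | toSet (ω j) = S ∧ ∀ k, k ≠ j → ¬ toSet (ω k) ⊂ S} (fun _ => (1 : ℝ)) ω
        ∂(hyperMeasure n m p) :=
        integral_mono .of_finite .of_finite minCount_le_s2
    _ = ∑ S : Finset (Fin n), ∑ j : Fin m, (hyperMeasure n m p).real
          {ω | toSet (ω j) = S ∧ ∀ k, k ≠ j → ¬ toSet (ω k) ⊂ S} := by
        rw [integral_finsetSum _ fun _ _ => .of_finite]
        refine Finset.sum_congr rfl fun S _ => ?_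
        rw [integral_finsetSum _ fun _ _ => .of_finite]
        refine Finset.sum_congr rfl fun j _ => ?_
        exact integral_indicator_one (Set.toFinite _).measurableSet
    _ = _ := by
        simp only [hyperMeasure_real_eq_and_not_ssubset hp0 hp1, Finset.sum_const, Finset.card_univ,
          Fintype.card_fin, nsmul_eq_mul]
        rw [← Finset.powerset_univ, Finset.sum_powerset_apply_card (fun k => (m : ℝ) *
          (p ^ k * (1 - p) ^ (n - k) * (1 - (1 - p) ^ (n - k) * (1 - p ^ k)) ^ (m - 1)))]
        simp

end

theorem two_rpow_binEnt_mul_eq {p α : ℝ} (n : ℝ) :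
    (2 : ℝ) ^ ((binEnt α + (1 - α) * Real.logb 2 p) * n)
      = Real.exp ((-(α * Real.log α) - (1 - α) * Real.log (1 - α) + (1 - α) * Real.log p) * n) := by
  have h2 : Real.log 2 ≠ 0 := (Real.log_pos one_lt_two).ne'
  rw [Real.rpow_def_of_pos two_pos, binEnt, Real.logb, Real.logb, Real.logb]
  congr 1
  field_simp

theorem choose_mul_edge_weight_le {p α : ℝ} (hp0 : 0 < p) (hp1 : p < 1) (hα0 : 0 < α)
    (hα1 : α < 1) {n k : ℕ} (hn : 0 < n) (hk : k ≤ n) :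
    (n.choose k : ℝ) * ((1 - p) ^ (-(α * n)) * (p ^ k * (1 - p) ^ (n - k)))
      ≤ 1 / (α * (1 - α)) * (2 : ℝ) ^ ((binEnt α + (1 - α) * Real.logb 2 p) * n) / √n
        * ((1 - p) * (1 - α) / (p * α)) ^ ((1 - α) * n - k) := by
  have hq : 0 < 1 - p := by linarith
  have hβ : 0 < 1 - α := by linarith
  obtain ⟨j, rfl⟩ := Nat.exists_eq_add_of_le hk
  have hch := choose_mul_pow_mul_pow_le hβ hα0 (by ring) hn
  rw [Nat.add_sub_cancel_left]
  have key : (1 - p) ^ (-(α * ((k + j : ℕ) : ℝ))) * (p ^ k * (1 - p) ^ j)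
      = (2 : ℝ) ^ ((binEnt α + (1 - α) * Real.logb 2 p) * ((k + j : ℕ) : ℝ))
        * ((1 - p) * (1 - α) / (p * α)) ^ ((1 - α) * ((k + j : ℕ) : ℝ) - k)
        * ((1 - α) ^ k * α ^ j) := by
    have hpow : ∀ {x : ℝ} (l : ℕ), 0 < x → x ^ l = Real.exp (l * Real.log x) := by
      intro x l hx
      rw [Real.exp_nat_mul, Real.exp_log hx]
    rw [two_rpow_binEnt_mul_eq, Real.rpow_def_of_pos hq,
      Real.rpow_def_of_pos (by positivity : 0 < (1 - p) * (1 - α) / (p * α)),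
      Real.log_div (by positivity) (by positivity), Real.log_mul hq.ne' hβ.ne',
      Real.log_mul hp0.ne' hα0.ne', hpow k hp0, hpow j hq, hpow k hβ, hpow j hα0]
    simp only [← Real.exp_add]
    congr 1
    push_cast
    ring
  rw [key]
  push_cast at hch ⊢
  set T := (2 : ℝ) ^ ((binEnt α + (1 - α) * Real.logb 2 p) * ((k : ℝ) + j))
  set D := ((1 - p) * (1 - α) / (p * α)) ^ ((1 - α) * ((k : ℝ) + j) - k)
  have hT : 0 ≤ T := by positivity
  have hD : 0 ≤ D := by positivity
  calc ((k + j).choose k : ℝ) * (T * D * ((1 - α) ^ k * α ^ j))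
      = ((k + j).choose k : ℝ) * (1 - α) ^ k * α ^ j * (T * D) := by ring
    _ ≤ 1 / ((1 - α) * α * √((k : ℝ) + j)) * (T * D) := by gcongr
    _ = _ := by
        field_simp

theorem rpow_mul_exp_neg_rpow_le {q r R s d : ℝ} (hq : 0 < q) (hr : 0 < r) (hrR : r ≤ R)
    {N : ℕ} (hs : q ^ N / r ≤ s) (hd : d ≤ 0) :
    R ^ d * Real.exp (-(q / 2 * q ^ d)) ≤ N.factorial * (2 / q) ^ N * s ^ (-d) := by
  have hy : 0 < q / 2 * q ^ d := by positivity
  have h1 : Real.exp (-(q / 2 * q ^ d)) ≤ N.factorial / (q / 2 * q ^ d) ^ N := by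
    have := Real.pow_div_factorial_le_exp _ hy.le N
    rw [Real.exp_neg, inv_le_comm₀ (Real.exp_pos _) (by positivity), inv_div]
    exact this
  have h2 : R ^ d ≤ r ^ d := Real.rpow_le_rpow_of_nonpos hr hrR hd
  have h3 : (q ^ N / r) ^ (-d) ≤ s ^ (-d) := Real.rpow_le_rpow (by positivity) hs (by linarith)
  have h4 : (q ^ N / r) ^ (-d) = r ^ d / (q ^ d) ^ N := by
    rw [Real.div_rpow (by positivity) hr.le, Real.rpow_neg hr.le, Real.rpow_neg (by positivity),
      ← Real.rpow_natCast, ← Real.rpow_natCast, ← Real.rpow_mul hq.le, ← Real.rpow_mul hq.le,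
      mul_comm d]
    field_simp
  calc R ^ d * Real.exp (-(q / 2 * q ^ d))
      ≤ r ^ d * (N.factorial / (q / 2 * q ^ d) ^ N) := by gcongr
    _ = N.factorial * (2 / q) ^ N * (q ^ N / r) ^ (-d) := by
        rw [h4, mul_pow, div_pow, div_pow]
        field_simp
    _ ≤ _ := by gcongr

theorem one_sub_pow_pred_le_exp {p α : ℝ} (hp0 : 0 < p) (hp1 : p < 1) {n k m : ℕ}
    (hk : k ≤ n) (hk0 : 0 < k) (hm : 2 ≤ m) (hmα : (m : ℝ) = (1 - p) ^ (-(α * n))) :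
    (1 - (1 - p) ^ (n - k) * (1 - p ^ k)) ^ (m - 1)
      ≤ Real.exp (-((1 - p) / 2 * (1 - p) ^ ((1 - α) * n - k))) := by
  have hq : 0 < 1 - p := by linarith
  have hpk : p ^ k ≤ p := pow_le_of_le_one hp0.le hp1.le hk0.ne'
  have hpk0 : 0 < p ^ k := by positivity
  have hqk0 : 0 < (1 - p) ^ (n - k) := by positivity
  have hqk1 : (1 - p) ^ (n - k) ≤ 1 := pow_le_one₀ hq.le (by linarith)
  have hd : (1 - p) ^ ((1 - α) * n - k) = m * (1 - p) ^ (n - k) := by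
    rw [hmα, ← Real.rpow_natCast, ← Real.rpow_add hq, Nat.cast_sub hk]
    congr 1
    ring
  have hm1 : ((m - 1 : ℕ) : ℝ) = m - 1 := by
    rw [Nat.cast_sub (by omega), Nat.cast_one]
  have hm2 : (2 : ℝ) ≤ m := by exact_mod_cast hm
  calc (1 - (1 - p) ^ (n - k) * (1 - p ^ k)) ^ (m - 1)
      ≤ Real.exp (-((1 - p) ^ (n - k) * (1 - p ^ k))) ^ (m - 1) := by
        refine pow_le_pow_left₀ ?_ (Real.one_sub_le_exp_neg _) _
        nlinarith
    _ = Real.exp (-((m - 1) * ((1 - p) ^ (n - k) * (1 - p ^ k)))) := by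
        rw [← Real.exp_nat_mul, hm1]
        congr 1
        ring
    _ ≤ _ := by
        rw [Real.exp_le_exp, neg_le_neg_iff, hd]
        calc (1 - p) / 2 * (m * (1 - p) ^ (n - k))
            = (m / 2) * ((1 - p) ^ (n - k) * (1 - p)) := by ring
          _ ≤ (m - 1) * ((1 - p) ^ (n - k) * (1 - p ^ k)) := by
              gcongr <;> linarith

theorem one_sub_pow_mul_one_sub_pow_mem_Icc {p : ℝ} (hp0 : 0 < p) (hp1 : p < 1) (j k : ℕ) :
    1 - (1 - p) ^ j * (1 - p ^ k) ∈ Set.Icc (0 : ℝ) 1 := by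
  have ha : 0 < (1 - p) ^ j := pow_pos (by linarith) _
  have ha' : (1 - p) ^ j ≤ 1 := pow_le_one₀ (by linarith) (by linarith)
  have hb : 0 < p ^ k := by positivity
  have hb' : p ^ k ≤ 1 := pow_le_one₀ hp0.le hp1.le
  constructor <;> nlinarith

theorem rpow_mul_one_sub_pow_le {p α r R s : ℝ} (hp0 : 0 < p) (hp1 : p < 1) (hα1 : α < 1)
    {n k m : ℕ} (hn : 0 < n) (hk : k ≤ n) (hm : 2 ≤ m) (hmα : (m : ℝ) = (1 - p) ^ (-(α * n)))
    (hr : 0 < r) (hrR : r ≤ R) (hRs : R ≤ s) (hs0 : 0 < s) {N : ℕ} (hs : (1 - p) ^ N / r ≤ s) :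
    R ^ ((1 - α) * n - k) * (1 - (1 - p) ^ (n - k) * (1 - p ^ k)) ^ (m - 1)
      ≤ (1 + N.factorial * (2 / (1 - p)) ^ N) * s ^ |(1 - α) * n - k| := by
  have hq : 0 < 1 - p := by linarith
  have hR0 : 0 < R := hr.trans_le hrR
  have hE := one_sub_pow_mul_one_sub_pow_mem_Icc hp0 hp1 (n - k) k
  have hN : 0 ≤ N.factorial * (2 / (1 - p)) ^ N := by positivity
  rcases le_total 0 ((1 - α) * n - k) with hd | hd
  · rw [abs_of_nonneg hd]
    calc R ^ ((1 - α) * n - k) * (1 - (1 - p) ^ (n - k) * (1 - p ^ k)) ^ (m - 1)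
        ≤ R ^ ((1 - α) * n - k) :=
          mul_le_of_le_one_right (Real.rpow_nonneg hR0.le _) (pow_le_one₀ hE.1 hE.2)
      _ ≤ s ^ ((1 - α) * n - k) := Real.rpow_le_rpow hR0.le hRs hd
      _ ≤ _ := le_mul_of_one_le_left (Real.rpow_nonneg hs0.le _) (by linarith)
  · have hk0 : 0 < k := by
      have h1 : 0 < (1 - α) * n := mul_pos (by linarith) (by exact_mod_cast hn)
      have h2 : (0 : ℝ) < k := by linarith
      exact_mod_cast h2
    rw [abs_of_nonpos hd]
    calc R ^ ((1 - α) * n - k) * (1 - (1 - p) ^ (n - k) * (1 - p ^ k)) ^ (m - 1)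
        ≤ R ^ ((1 - α) * n - k)
          * Real.exp (-((1 - p) / 2 * (1 - p) ^ ((1 - α) * n - k))) :=
          mul_le_mul_of_nonneg_left (one_sub_pow_pred_le_exp hp0 hp1 hk hk0 hm hmα)
            (Real.rpow_nonneg hR0.le _)
      _ ≤ N.factorial * (2 / (1 - p)) ^ N * s ^ (-((1 - α) * n - k)) :=
          rpow_mul_exp_neg_rpow_le hq hr hrR hs hd
      _ ≤ _ := mul_le_mul_of_nonneg_right (by linarith) (Real.rpow_nonneg hs0.le _)

/-- **Upper bound in the information-theoretic regime.** For
`1/(1-p)^{(1-p+ε)n} ≤ m ≤ 1/(1-p)^{(1-ε')n}`, with `α = -(log m)/(n·log(1-p))`,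
`E[|min(B_{n,m,p})|] ≤ C · 2^{(Hb(α)+(1-α)·log₂ p)·n} / √n`. -/
theorem info_regime_upper (p : ℝ) (hp0 : 0 < p) (hp1 : p < 1)
    (ε ε' : ℝ) (hε : 0 < ε) (hε' : 0 < ε') :
    ∃ C > (0 : ℝ), ∀ n m : ℕ, 0 < n → 0 < m →
      1 / (1 - p) ^ ((1 - p + ε) * n) ≤ (m : ℝ) →
      (m : ℝ) ≤ 1 / (1 - p) ^ ((1 - ε') * n) →
      ∀ α : ℝ, α = -(Real.log m) / (n * Real.log (1 - p)) →
      expMin n m p ≤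
        C * (2 : ℝ) ^ ((binEnt α + (1 - α) * Real.logb 2 p) * n) / Real.sqrt n := by
  have hq : 0 < 1 - p := by linarith
  set r : ℝ := (1 - p) * ε' / p with hr
  have hr0 : 0 < r := by positivity
  obtain ⟨N, hN⟩ := exists_pow_lt_of_lt_one hr0 (by linarith : 1 - p < 1)
  set ρ : ℝ := (1 - p) * (p - ε) / (p * (1 - p + ε)) with hρ
  have hρ1 : ρ < 1 := by
    rw [hρ, div_lt_one (by positivity)]
    nlinarith
  set s : ℝ := max ρ ((1 - p) ^ N / r) with hs
  have hs0 : 0 < s := lt_max_of_lt_right (by positivity)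
  have hs1 : s < 1 := max_lt hρ1 ((div_lt_one hr0).2 hN)
  set K : ℝ := 1 + N.factorial * (2 / (1 - p)) ^ N with hK
  have h1s : 0 < 1 - s := by linarith
  refine ⟨1 / ((1 - p) * ε') * (K * (2 / (s * (1 - s)))), by positivity, ?_⟩
  intro n m hn hm hlow hupp α hα
  have hn' : (0 : ℝ) < n := by exact_mod_cast hn
  have hm' : (0 : ℝ) < m := by exact_mod_cast hm
  have hL : Real.log (1 - p) < 0 := Real.log_neg hq (by linarith)
  have hnL : (n : ℝ) * Real.log (1 - p) < 0 := mul_neg_of_pos_of_neg hn' hL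
  have hαL : α * (n * Real.log (1 - p)) = -Real.log m := by
    rw [hα, div_mul_cancel₀ _ hnL.ne]
  have hlow' : (1 - p + ε) * (n * -Real.log (1 - p)) ≤ Real.log m := by
    have h := Real.log_le_log (by positivity) hlow
    rw [one_div, Real.log_inv, Real.log_rpow hq] at h
    linarith
  have hupp' : Real.log m ≤ (1 - ε') * (n * -Real.log (1 - p)) := by
    have h := Real.log_le_log hm' hupp
    rw [one_div, Real.log_inv, Real.log_rpow hq] at h
    linarith
  have hα_low : 1 - p + ε ≤ α := by
    refine le_of_mul_le_mul_right ?_ (neg_pos.2 hnL)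
    linarith
  have hα_upp : α ≤ 1 - ε' := by
    refine le_of_mul_le_mul_right ?_ (neg_pos.2 hnL)
    linarith
  have hα0 : 0 < α := by linarith
  have hα1 : α < 1 := by linarith
  have hβ : 0 < 1 - α := by linarith
  have hm2 : 2 ≤ m := by
    have h : 0 < Real.log m := lt_of_lt_of_le
      (mul_pos (by linarith) (mul_pos hn' (neg_pos.2 hL))) hlow'
    have h1 : (1 : ℝ) < m := (Real.log_pos_iff hm'.le).1 h
    exact_mod_cast h1
  have hmα : (m : ℝ) = (1 - p) ^ (-(α * n)) := by
    rw [Real.rpow_def_of_pos hq, show Real.log (1 - p) * -(α * n) = Real.log m by linarith,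
      Real.exp_log hm']
  set R : ℝ := (1 - p) * (1 - α) / (p * α) with hR
  have hR0 : 0 < R := by positivity
  have hRs : R ≤ s := by
    refine le_trans ?_ (le_max_left _ _)
    rw [hR, hρ]
    have h1 : 1 - α ≤ p - ε := by linarith
    have h2 : 0 ≤ p - ε := by linarith
    gcongr
  have hrR : r ≤ R := by
    rw [hR, hr, div_le_div_iff₀ hp0 (by positivity)]
    have : ε' * α ≤ 1 - α := by nlinarith
    nlinarith [mul_pos hq hp0]
  have hdecay : ∀ k ∈ Finset.range (n + 1),
      R ^ ((1 - α) * n - k) * (1 - (1 - p) ^ (n - k) * (1 - p ^ k)) ^ (m - 1)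
        ≤ K * s ^ |(1 - α) * n - k| := fun k hk =>
    rpow_mul_one_sub_pow_le hp0 hp1 hα1 hn (Nat.lt_succ_iff.1 (Finset.mem_range.1 hk)) hm2 hmα
      hr0 hrR hRs hs0 (le_max_right _ _)
  set T : ℝ := (2 : ℝ) ^ ((binEnt α + (1 - α) * Real.logb 2 p) * n) with hT
  have hT0 : 0 < T := by positivity
  calc expMin n m p
      ≤ ∑ k ∈ Finset.range (n + 1), (n.choose k : ℝ) * (m * (p ^ k * (1 - p) ^ (n - k)
        * (1 - (1 - p) ^ (n - k) * (1 - p ^ k)) ^ (m - 1))) := expMin_le_s2 hp0.le hp1.le n m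
    _ ≤ ∑ k ∈ Finset.range (n + 1),
          1 / (α * (1 - α)) * T / √n * (K * s ^ |(1 - α) * n - k|) := by
        refine Finset.sum_le_sum fun k hk => ?_
        have hkn : k ≤ n := Nat.lt_succ_iff.1 (Finset.mem_range.1 hk)
        have hE : 0 ≤ (1 - (1 - p) ^ (n - k) * (1 - p ^ k)) ^ (m - 1) :=
          pow_nonneg (one_sub_pow_mul_one_sub_pow_mem_Icc hp0 hp1 (n - k) k).1 _
        have h := choose_mul_edge_weight_le hp0 hp1 hα0 hα1 hn hkn
        rw [← hmα] at h
        calc _ = (n.choose k : ℝ) * (m * (p ^ k * (1 - p) ^ (n - k)))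
              * (1 - (1 - p) ^ (n - k) * (1 - p ^ k)) ^ (m - 1) := by ring
          _ ≤ 1 / (α * (1 - α)) * T / √n * R ^ ((1 - α) * n - k)
              * (1 - (1 - p) ^ (n - k) * (1 - p ^ k)) ^ (m - 1) := by gcongr
          _ = 1 / (α * (1 - α)) * T / √n * (R ^ ((1 - α) * n - k)
              * (1 - (1 - p) ^ (n - k) * (1 - p ^ k)) ^ (m - 1)) := by ring
          _ ≤ _ := mul_le_mul_of_nonneg_left (hdecay k hk) (by positivity)
    _ ≤ 1 / (α * (1 - α)) * T / √n * (K * (2 / (s * (1 - s)))) := by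
        rw [← Finset.mul_sum, ← Finset.mul_sum]
        gcongr
        exact sum_rpow_abs_sub_le hs0 hs1 (by positivity) _
    _ ≤ 1 / ((1 - p) * ε') * T / √n * (K * (2 / (s * (1 - s)))) := by
        gcongr <;> linarith
    _ = _ := by ring
end
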